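/- Let R be a set of nonnegative reals with 0 ∈ R such that 0 is a limit point of R. Then there exists an Urysohn metric space U with dist(U) = R if and only if R is a closed subset of ℝ and R satisfies the 4-values condition. -/

import Mathlib

/-- The set of distances realized in a metric space. -/
def distSet (X : Type*) [MetricSpace X] : Set ℝ :=
  {r : ℝ | ∃ x y : X, dist x y = r}

/-- A metric space is homogeneous if every isometry from a finite subset into the
space extends to a bijective self-isometry. -/
def IsHomogeneous (X : Type*) [MetricSpace X] : Prop :=
  ∀ F : Set X, F.Finite →
    ∀ f : F → X, (∀ x y : F, dist (f x) (f y) = dist (x : X) (y : X)) →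
      ∃ g : X ≃ᵢ X, ∀ x : F, g (x : X) = f x

/-- A metric space is universal if it is homogeneous and embeds isometrically every
finite metric space whose distances lie in its distance set. -/
def IsUniversal (X : Type*) [MetricSpace X] : Prop :=
  IsHomogeneous X ∧
    ∀ (F : Type) [MetricSpace F] [Finite F], distSet F ⊆ distSet X →
      ∃ f : F → X, ∀ a b : F, dist (f a) (f b) = dist a b

/-- An Urysohn metric space: homogeneous, separable, complete, and embedding every
separable metric space whose distances lie in its distance set. -/
def IsUrysohn (X : Type*) [MetricSpace X] : Prop :=
  IsHomogeneous X ∧ TopologicalSpace.SeparableSpace X ∧ CompleteSpace X ∧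
    ∀ (N : Type) [MetricSpace N] [TopologicalSpace.SeparableSpace N],
      distSet N ⊆ distSet X →
        ∃ f : N → X, ∀ a b : N, dist (f a) (f b) = dist a b

/-- The triple `(a, b, c)` of nonnegative reals is metric: `|a - b| ≤ c ≤ a + b`. -/
def MetricTriple (a b c : ℝ) : Prop := |a - b| ≤ c ∧ c ≤ a + b

/-- `x ⤳ (a, b, c, d)`: the triples `(x,a,b)` and `(x,c,d)` are metric and
`a ≥ max {b, c, d}`. -/
def Leads (x a b c d : ℝ) : Prop :=
  MetricTriple x a b ∧ MetricTriple x c d ∧ b ≤ a ∧ c ≤ a ∧ d ≤ a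

/-- The 4-values condition. -/
def FourValues (R : Set ℝ) : Prop :=
  ∀ a b c d, a ∈ R → b ∈ R → c ∈ R → d ∈ R →
    (∃ x ∈ R, Leads x a b c d) → ∃ y ∈ R, Leads y a d c b

/-- `0` is a limit point of `R ⊆ [0, ∞)`. -/
def ZeroLimit (R : Set ℝ) : Prop := ∀ ε > 0, ∃ r ∈ R, 0 < r ∧ r < ε

/-- `d` is a metric on the type `α`. -/
def IsMetricOn {α : Type*} (d : α → α → ℝ) : Prop :=
  (∀ x, d x x = 0) ∧ (∀ x y, d x y = d y x) ∧
    (∀ x y z, d x z ≤ d x y + d y z) ∧ ∀ x y, d x y = 0 → x = y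

/-- A restricted type function of the metric space `X`: a positive real valued function on a
finite subset of `X`, compatible with the metric, with values in the distance set of `X`. -/
def IsRestrictedType (X : Type*) [MetricSpace X] (F : Set X) (t : F → ℝ) : Prop :=
  F.Finite ∧ (∀ x, 0 < t x) ∧
    (∀ x y : F, |t x - t y| ≤ dist (x : X) (y : X) ∧ dist (x : X) (y : X) ≤ t x + t y) ∧
    ∀ x, t x ∈ distSet X

/-- A Katětov function of the metric space `X`: a positive real valued function on a finite
subset of `X` whose one-point extension `Sp(k)` is isometric to a subspace of `X`. -/
def IsKatetov (X : Type*) [MetricSpace X] (F : Set X) (k : F → ℝ) : Prop :=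
  F.Finite ∧ (∀ x, 0 < k x) ∧
    ∃ (g : F → X) (p : X),
      (∀ x y : F, dist (g x) (g y) = dist (x : X) (y : X)) ∧ ∀ x : F, dist p (g x) = k x

/-- `p` realizes the type function `t` in `X`. -/
def Realizes {X : Type*} [MetricSpace X] (F : Set X) (t : F → ℝ) (p : X) : Prop :=
  ∀ x : F, dist p (x : X) = t x

open Set Filter Topology

/-! ### Metric triples and Katětov functions -/

theorem MetricTriple.swap {a b c : ℝ} (h : MetricTriple a b c) : MetricTriple b a c :=
  ⟨by rw [abs_sub_comm]; exact h.1, by linarith [h.2]⟩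

theorem MetricTriple.rotate {a b c : ℝ} (h : MetricTriple a b c) : MetricTriple b c a := by
  obtain ⟨h1, h2⟩ := h
  obtain ⟨h3, h4⟩ := abs_le.1 h1
  exact ⟨abs_le.2 ⟨by linarith, by linarith⟩, by linarith⟩

theorem MetricTriple.swap_right {a b c : ℝ} (h : MetricTriple a b c) : MetricTriple a c b :=
  h.swap.rotate

theorem metricTriple_dist {X : Type*} [PseudoMetricSpace X] (x y z : X) :
    MetricTriple (dist x y) (dist x z) (dist y z) := by
  refine ⟨abs_le.2 ⟨?_, ?_⟩, ?_⟩ <;>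
  linarith [dist_triangle x y z, dist_triangle x z y, dist_triangle y x z, dist_comm x y,
    dist_comm y z]

/-- The 4-values condition without its maximality clause. -/
theorem FourValues.amalgam {R : Set ℝ} (h : FourValues R) {x a b c d : ℝ} (hx : x ∈ R)
    (ha : a ∈ R) (hb : b ∈ R) (hc : c ∈ R) (hd : d ∈ R) (h1 : MetricTriple x a b)
    (h2 : MetricTriple x c d) : ∃ y ∈ R, MetricTriple y a c ∧ MetricTriple y b d := by
  have key : ∀ a b c d, a ∈ R → b ∈ R → c ∈ R → d ∈ R → MetricTriple x a b →
      MetricTriple x c d → b ≤ a → c ≤ a → d ≤ a →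
      ∃ y ∈ R, MetricTriple y a c ∧ MetricTriple y b d := by
    intro a b c d ha hb hc hd h1 h2 hba hca hda
    obtain ⟨y, hy, h3, h4, -⟩ := h a b d c ha hb hd hc
      ⟨x, hx, h1, h2.swap_right, hba, hda, hca⟩
    exact ⟨y, hy, h3, h4.swap_right⟩
  rcases le_total b a with hba | hab
  all_goals rcases le_total d c with hdc | hcd
  · rcases le_total c a with hca | hac
    · exact key a b c d ha hb hc hd h1 h2 hba hca (hdc.trans hca)
    · obtain ⟨y, hy, h3, h4⟩ := key c d a b hc hd ha hb h2 h1 hdc hac (hba.trans hac)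
      exact ⟨y, hy, h3.swap_right, h4.swap_right⟩
  · rcases le_total d a with hda | had
    · exact key a b c d ha hb hc hd h1 h2 hba (hcd.trans hda) hda
    · obtain ⟨y, hy, h3, h4⟩ :=
        key d c b a hd hc hb ha h2.swap_right h1.swap_right hcd (hba.trans had) had
      exact ⟨y, hy, h4.swap_right, h3.swap_right⟩
  · rcases le_total b c with hbc | hcb
    · obtain ⟨y, hy, h3, h4⟩ := key c d a b hc hd ha hb h2 h1 hdc (hab.trans hbc) hbc
      exact ⟨y, hy, h3.swap_right, h4.swap_right⟩
    · obtain ⟨y, hy, h3, h4⟩ :=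
        key b a d c hb ha hd hc h1.swap_right h2.swap_right hab (hdc.trans hcb) hcb
      exact ⟨y, hy, h4, h3⟩
  · rcases le_total b d with hbd | hdb
    · obtain ⟨y, hy, h3, h4⟩ :=
        key d c b a hd hc hb ha h2.swap_right h1.swap_right hcd hbd (hab.trans hbd)
      exact ⟨y, hy, h4.swap_right, h3.swap_right⟩
    · obtain ⟨y, hy, h3, h4⟩ :=
        key b a d c hb ha hd hc h1.swap_right h2.swap_right hab hdb (hcd.trans hdb)
      exact ⟨y, hy, h4, h3⟩

/-- `d` is a pseudometric with values in `R`. -/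
structure IsDistIn (R : Set ℝ) {α : Type*} (d : α → α → ℝ) : Prop where
  mem : ∀ x y, d x y ∈ R
  self : ∀ x, d x x = 0
  symm : ∀ x y, d x y = d y x
  triangle : ∀ x y z, d x z ≤ d x y + d y z

/-- `t` is a Katětov function on `F` with values in `R`. -/
def KatetovOn (R : Set ℝ) {α : Type*} (d : α → α → ℝ) (F : Set α) (t : α → ℝ) : Prop :=
  (∀ x ∈ F, t x ∈ R) ∧ ∀ x ∈ F, ∀ y ∈ F, MetricTriple (t x) (t y) (d x y)

variable {R : Set ℝ} {α : Type*} {d : α → α → ℝ} {F G : Set α} {t : α → ℝ}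

theorem IsDistIn.of_dist {X : Type*} [PseudoMetricSpace X] (h : ∀ x y : X, dist x y ∈ R) :
    IsDistIn R (dist : X → X → ℝ) :=
  ⟨h, dist_self, dist_comm, dist_triangle⟩

theorem KatetovOn.mono (h : KatetovOn R d G t) (hFG : F ⊆ G) : KatetovOn R d F t :=
  ⟨fun x hx => h.1 x (hFG hx), fun x hx y hy => h.2 x (hFG hx) y (hFG hy)⟩

theorem KatetovOn.congr {s : α → ℝ} (h : KatetovOn R d F t) (hst : ∀ x ∈ F, s x = t x) :
    KatetovOn R d F s :=
  ⟨fun x hx => by rw [hst x hx]; exact h.1 x hx,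
    fun x hx y hy => by rw [hst x hx, hst y hy]; exact h.2 x hx y hy⟩

open Classical in
theorem KatetovOn.update_insert (hd : IsDistIn R d) (h : KatetovOn R d F t) {z : α} {r : ℝ} (hr : r ∈ R)
    (hr0 : 0 ≤ r) (hz : ∀ x ∈ F, MetricTriple (t x) r (d x z)) :
    KatetovOn R d (insert z F) (Function.update t z r) := by
  have hF : ∀ {x}, x ∈ insert z F → x ≠ z → x ∈ F := fun hx hne => hx.resolve_left hne
  refine ⟨fun x hx => ?_, fun x hx y hy => ?_⟩
  · by_cases hxz : x = z
    · simpa [hxz] using hr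
    · simpa [hxz] using h.1 x (hF hx hxz)
  · by_cases hxz : x = z <;> by_cases hyz : y = z
    · simp [hxz, hyz, MetricTriple, hd.self, hr0]
    · simpa [hxz, hyz, hd.symm z y] using (hz y (hF hy hyz)).swap
    · simpa [hxz, hyz] using hz x (hF hx hxz)
    · simpa [hxz, hyz] using h.2 x (hF hx hxz) y (hF hy hyz)

theorem KatetovOn.exists_insert (h4 : FourValues R) (h0 : (0 : ℝ) ∈ R) (hd : IsDistIn R d)
    (hF : F.Finite) (h : KatetovOn R d F t) (z : α) :
    ∃ s, KatetovOn R d (insert z F) s ∧ ∀ x ∈ F, s x = t x := by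
  classical
  by_cases hzF : z ∈ F
  · exact ⟨t, by rwa [insert_eq_of_mem hzF], fun _ _ => rfl⟩
  suffices ∃ r ∈ R, 0 ≤ r ∧ ∀ x ∈ F, MetricTriple (t x) r (d x z) by
    obtain ⟨r, hr, hr0, hz⟩ := this
    refine ⟨_, h.update_insert hd hr hr0 hz, fun x hx => ?_⟩
    exact Function.update_of_ne (ne_of_mem_of_not_mem hx hzF) _ _
  rcases F.eq_empty_or_nonempty with rfl | hne
  · exact ⟨0, h0, le_rfl, by simp⟩
  obtain ⟨a, ha, hmax⟩ := hF.exists_maximalFor (fun x => |t x - d x z|) F hne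
  obtain ⟨b, hb, hmin⟩ := hF.exists_minimalFor (fun x => t x + d x z) F hne
  have h5 : MetricTriple (d a z) (d b z) (d a b) := by
    refine ⟨abs_le.2 ⟨?_, ?_⟩, ?_⟩ <;>
    linarith [hd.triangle a b z, hd.triangle b a z, hd.triangle a z b, hd.symm a b, hd.symm z b]
  obtain ⟨y, hy, h6, h7⟩ := h4.amalgam (hd.mem a b) (h.1 a ha) (h.1 b hb) (hd.mem a z)
    (hd.mem b z) (h.2 a ha b hb).rotate.rotate h5.rotate.rotate
  have h8 := h6.rotate.1
  have hmax' : ∀ x ∈ F, |t x - d x z| ≤ y := fun x hx =>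
    (le_total |t x - d x z| |t a - d a z|).elim (fun hh => hh.trans h8)
      (fun hh => (hmax hx hh).trans h8)
  have hmin' : ∀ x ∈ F, y ≤ t x + d x z := fun x hx =>
    (le_total (t b + d b z) (t x + d x z)).elim (fun hh => (h7.rotate.2).trans hh)
      (fun hh => (h7.rotate.2).trans (hmin hx hh))
  refine ⟨y, hy, (abs_nonneg _).trans h8, fun x hx => ?_⟩
  exact MetricTriple.swap_right ⟨hmax' x hx, hmin' x hx⟩

theorem KatetovOn.exists_union (h4 : FourValues R) (h0 : (0 : ℝ) ∈ R) (hd : IsDistIn R d)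
    (hF : F.Finite) (h : KatetovOn R d F t) (hG : G.Finite) :
    ∃ s, KatetovOn R d (F ∪ G) s ∧ ∀ x ∈ F, s x = t x := by
  induction G, hG using Set.Finite.induction_on with
  | empty => exact ⟨t, by simpa using h, fun _ _ => rfl⟩
  | @insert z G _ hG ih =>
    obtain ⟨s, hs, hst⟩ := ih
    obtain ⟨s', hs', hst'⟩ := hs.exists_insert h4 h0 hd (hF.union hG) z
    exact ⟨s', by rwa [union_insert], fun x hx => (hst' x (.inl hx)).trans (hst x hx)⟩

/-! ### A countable space with the approximate extension property -/

/-- Katětov functions on finite sets are approximately realized. -/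
def ApproxExtension (R : Set ℝ) {α : Type*} (d : α → α → ℝ) : Prop :=
  ∀ F : Set α, F.Finite → ∀ t, KatetovOn R d F t → ∀ ε > 0, ∃ p, ∀ x ∈ F, |d p x - t x| < ε

theorem exists_realizing_step (h4 : FourValues R) (h0 : (0 : ℝ) ∈ R) (n k : ℕ)
    (q : ℕ → ℝ) (ε : ℝ) (d : ℕ → ℕ → ℝ) (hd : IsDistIn R d) :
    ∃ d' : ℕ → ℕ → ℝ, IsDistIn R d' ∧ (∀ i < n, ∀ j < n, d' i j = d i j) ∧
      (k ≤ n → (∃ s, KatetovOn R d (Iio k) s ∧ ∀ i < k, |s i - q i| < ε) →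
        ∀ i < k, |d' n i - q i| < ε) := by
  by_cases hk : k ≤ n ∧ ∃ s, KatetovOn R d (Iio k) s ∧ ∀ i < k, |s i - q i| < ε
  swap
  · exact ⟨d, hd, fun _ _ _ _ => rfl, fun h1 h2 => absurd ⟨h1, h2⟩ hk⟩
  obtain ⟨hkn, s, hs, hsq⟩ := hk
  obtain ⟨s', hs', hss'⟩ := hs.exists_union h4 h0 hd (finite_Iio k) (finite_Iio n)
  have h : KatetovOn R d (Iio n) s' := hs'.mono subset_union_right
  let d' : ℕ → ℕ → ℝ := fun i j => if i < n then (if j < n then d i j else s' i)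
    else (if j < n then s' j else 0)
  refine ⟨d', ⟨?_, ?_, ?_, ?_⟩, ?_, ?_⟩
  · intro i j
    simp only [d']
    split_ifs with hi hj hj
    exacts [hd.mem i j, h.1 i hi, h.1 j hj, h0]
  · intro i
    by_cases hi : i < n <;> simp [d', hd.self, hi]
  · intro i j
    simp only [d']
    split_ifs
    exacts [hd.symm i j, rfl, rfl, rfl]
  · intro i j l
    have hh : ∀ i < n, ∀ j < n, s' i ≤ d i j + s' j ∧ s' j ≤ s' i + d i j ∧
        d i j ≤ s' i + s' j ∧ 0 ≤ s' i := by
      intro i hi j hj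
      obtain ⟨h1, h2⟩ := h.2 i hi j hj
      obtain ⟨h3, h4⟩ := abs_le.1 h1
      exact ⟨by linarith, by linarith, h2, by linarith⟩
    have hij := hh i
    have hjl := hh j
    have hil := hh i
    have := hd.triangle i j l
    simp only [d']
    split_ifs <;> grind
  · intro i hi j hj
    simp [d', hi, hj]
  · intro _ _ i hi
    simpa [d', hi.trans_le hkn, hss' i hi] using hsq i hi

theorem exists_approxExtension (h4 : FourValues R) (h0 : (0 : ℝ) ∈ R) :
    ∃ d : ℕ → ℕ → ℝ, IsDistIn R d ∧ ApproxExtension R d := by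
  obtain ⟨f, hf⟩ := exists_surjective_nat (ℕ × List ℚ × ℕ)
  let k : ℕ → ℕ := fun n => (f n.unpair.1).1
  let q : ℕ → ℕ → ℝ := fun n i => ((f n.unpair.1).2.1.getD i 0 : ℚ)
  let e : ℕ → ℝ := fun n => 1 / ((f n.unpair.1).2.2 + 1 : ℝ)
  choose! step hstep using fun n d =>
    exists_realizing_step (R := R) h4 h0 n (k n) (q n) (e n) d
  let D : ℕ → ℕ → ℕ → ℝ := fun n => Nat.rec (fun _ _ => 0) step n
  have hD : ∀ n, IsDistIn R (D n) := by
    intro n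
    induction n with
    | zero => exact ⟨fun _ _ => h0, fun _ => rfl, fun _ _ => rfl, fun _ _ _ => by simp [D]⟩
    | succ n ih => exact (hstep n (D n) ih).1
  have hagree : ∀ n m, n ≤ m → ∀ i < n, ∀ j < n, D m i j = D n i j := by
    intro n m hnm
    induction m, hnm using Nat.le_induction with
    | base => exact fun _ _ _ _ => rfl
    | succ m hnm ih =>
      intro i hi j hj
      rw [← ih i hi j hj]
      exact (hstep m (D m) (hD m)).2.1 i (by omega) j (by omega)
  let d : ℕ → ℕ → ℝ := fun i j => D (max i j + 1) i j
  have hdD : ∀ n i j, i < n → j < n → d i j = D n i j := fun n i j hi hj =>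
    (hagree (max i j + 1) n (by omega) i (by omega) j (by omega)).symm
  have hd : IsDistIn R d := by
    refine ⟨fun i j => (hD (max i j + 1)).mem i j, fun i => (hD (max i i + 1)).self i, fun i j => ?_, fun i j l => ?_⟩
    · rw [hdD (i + j + 1) i j (by omega) (by omega), hdD (i + j + 1) j i (by omega) (by omega)]
      exact (hD (i + j + 1)).symm i j
    · rw [hdD (i + j + l + 1) i j (by omega) (by omega),
        hdD (i + j + l + 1) j l (by omega) (by omega),
        hdD (i + j + l + 1) i l (by omega) (by omega)]
      exact (hD (i + j + l + 1)).triangle i j l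
  refine ⟨d, hd, fun F hF t ht ε hε => ?_⟩
  obtain ⟨K, hK⟩ : ∃ K, F ⊆ Iio K := by
    obtain ⟨K, hK⟩ := hF.bddAbove
    exact ⟨K + 1, fun x hx => Nat.lt_succ_of_le (hK hx)⟩
  obtain ⟨s, hs, hst⟩ := ht.exists_union h4 h0 hd hF (finite_Iio K)
  obtain ⟨m, hm⟩ := exists_nat_one_div_lt (half_pos hε)
  have hm0 : (0 : ℝ) < 1 / ((m : ℝ) + 1) := by positivity
  choose r hr using fun i => exists_rat_near (s i) hm0
  obtain ⟨c, hc⟩ := hf (K, (List.range K).map r, m)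
  let n := Nat.pair c K
  have hk : k n = K := by simp [k, n, hc]
  have he : e n = 1 / ((m : ℝ) + 1) := by simp [e, n, hc]
  have hq : ∀ i < K, q n i = r i := by
    intro i hi
    simp [q, n, hc, hi]
  have hKn : K ≤ n := Nat.right_le_pair c K
  have hreal := (hstep n (D n) (hD n)).2.2
  rw [hk, he] at hreal
  have hex := hreal hKn ⟨s, ⟨fun i hi => hs.1 i (.inr hi), fun i hi j hj => ?_⟩, ?_⟩
  · refine ⟨n, fun i hi => ?_⟩
    have hiK : i < K := hK hi
    have h1 := hex i hiK
    have h2 := hr i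
    rw [hq i hiK, show step n (D n) n i = d n i from
      (hdD (n + 1) n i (by omega) (by omega)).symm] at h1
    rw [← hst i hi]
    rw [abs_lt] at *
    constructor <;> linarith [h1.1, h1.2, h2.1, h2.2]
  · rw [← hdD n i j (lt_of_lt_of_le hi hKn) (lt_of_lt_of_le hj hKn)]
    exact hs.2 i (.inr hi) j (.inr hj)
  · intro i hi
    rw [hq i hi]
    exact hr i

/-! ### The completion has the extension property -/

theorem ApproxExtension.completion {α : Type*} [PseudoMetricSpace α] (h4 : FourValues R)
    (h0 : (0 : ℝ) ∈ R) (h : ApproxExtension R (dist : α → α → ℝ))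
    (hR : ∀ x y : UniformSpace.Completion α, dist x y ∈ R) :
    ApproxExtension R (dist : UniformSpace.Completion α → UniformSpace.Completion α → ℝ) := by
  intro F hF t ht ε hε
  choose a ha using fun x : UniformSpace.Completion α =>
    (UniformSpace.Completion.denseRange_coe (α := α)).exists_dist_lt x
      (show 0 < ε / 3 by positivity)
  obtain ⟨s, hs, hst⟩ := ht.exists_union h4 h0 (IsDistIn.of_dist hR) hF
    ((hF.image a).image ((↑) : α → UniformSpace.Completion α))
  obtain ⟨p, hp⟩ := h (a '' F) (hF.image a) (fun x => s x)
    ⟨fun x hx => hs.1 _ (.inr (mem_image_of_mem _ hx)), fun x hx y hy => by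
      have := hs.2 _ (.inr (mem_image_of_mem _ hx)) _ (.inr (mem_image_of_mem _ hy))
      rwa [UniformSpace.Completion.dist_eq] at this⟩ (ε / 3) (by positivity)
  refine ⟨p, fun x hx => ?_⟩
  have h1 := hp _ (mem_image_of_mem _ hx)
  have h2 := (hs.2 x (.inl hx) (a x) (.inr (mem_image_of_mem _ (mem_image_of_mem _ hx)))).1
  have h3 := (metricTriple_dist (p : UniformSpace.Completion α) x (a x)).1
  have h5 := ha x
  rw [hst x hx] at h2
  rw [← UniformSpace.Completion.dist_eq] at h1
  rw [abs_lt] at *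
  rw [abs_le] at h2 h3
  constructor <;> linarith [h1.1, h1.2, h2.1, h2.2, h3.1, h3.2]

/-- Katětov functions on finite sets are realized. -/
def ExtensionProperty (R : Set ℝ) (X : Type*) [MetricSpace X] : Prop :=
  ∀ F : Set X, F.Finite → ∀ t, KatetovOn R dist F t → ∃ p, ∀ x ∈ F, dist p x = t x

theorem ApproxExtension.extensionProperty {X : Type*} [MetricSpace X] [CompleteSpace X]
    (hlim : ZeroLimit R) (hR : ∀ x y : X, dist x y ∈ R)
    (h : ApproxExtension R (dist : X → X → ℝ)) : ExtensionProperty R X := by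
  classical
  intro F hF t ht
  have htn : ∀ x ∈ F, 0 ≤ t x := fun x hx => by
    have := (ht.2 x hx x hx).2
    rw [dist_self] at this
    linarith
  by_cases hz : ∃ x ∈ F, t x = 0
  · obtain ⟨x, hx, hx0⟩ := hz
    refine ⟨x, fun y hy => ?_⟩
    obtain ⟨h1, h2⟩ := ht.2 x hx y hy
    rw [hx0, zero_sub, abs_neg, abs_of_nonneg (htn y hy)] at h1
    linarith
  push Not at hz
  obtain ⟨τ, hτ0, hτ⟩ : ∃ τ > 0, ∀ x ∈ F, τ ≤ t x := by
    rcases F.eq_empty_or_nonempty with rfl | hne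
    · exact ⟨1, one_pos, by simp⟩
    obtain ⟨b, hb, hmin⟩ := hF.exists_minimalFor t F hne
    refine ⟨t b, lt_of_le_of_ne (htn b hb) (hz b hb).symm, fun x hx => ?_⟩
    exact (le_total (t b) (t x)).elim id (fun hh => hmin hx hh)
  choose δ hδR hδ0 hδ using fun n : ℕ =>
    hlim (min τ ((1 / 2) ^ n)) (lt_min hτ0 (by positivity))
  have hδτ : ∀ n, δ n ≤ τ := fun n => (hδ n).le.trans (min_le_left _ _)
  have hδn : ∀ n, δ n ≤ (1 / 2) ^ n := fun n => (hδ n).le.trans (min_le_right _ _)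
  obtain ⟨p₀, hp₀⟩ := h F hF t ht (δ 0) (hδ0 0)
  have step : ∀ n p, (∀ x ∈ F, |dist p x - t x| < δ n) →
      ∃ p', (∀ x ∈ F, |dist p' x - t x| < δ (n + 1)) ∧ dist p p' ≤ 2 * δ n := by
    intro n p hp
    have hK : KatetovOn R dist (insert p F) (Function.update t p (δ n)) := by
      refine ht.update_insert (IsDistIn.of_dist hR) (hδR n) (hδ0 n).le fun x hx => ?_
      have h1 := abs_lt.1 (hp x hx)
      have h2 := hτ x hx
      have h3 := hδτ n
      have h5 := dist_nonneg (x := p) (y := x)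
      rw [dist_comm x p]
      exact ⟨abs_le.2 ⟨by linarith, by linarith⟩, by linarith⟩
    obtain ⟨p', hp'⟩ := h _ (hF.insert p) _ hK (min (δ n) (δ (n + 1)))
      (lt_min (hδ0 _) (hδ0 _))
    refine ⟨p', fun x hx => ?_, ?_⟩
    · have h1 := hp' x (.inr hx)
      by_cases hxp : x = p
      · subst hxp
        have h2 := abs_lt.1 (hp x hx)
        rw [dist_self] at h2
        linarith [hδτ n, hτ x hx]
      · rw [Function.update_of_ne hxp] at h1
        exact h1.trans_le (min_le_right _ _)
    · have h1 := hp' p (.inl rfl)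
      rw [Function.update_self] at h1
      have h2 := abs_lt.1 (h1.trans_le (min_le_left _ _))
      rw [dist_comm]
      linarith
  choose! next hnext1 hnext2 using step
  let p : ℕ → X := fun n => Nat.rec p₀ next n
  have hp : ∀ n, ∀ x ∈ F, |dist (p n) x - t x| < δ n := by
    intro n
    induction n with
    | zero => exact hp₀
    | succ n ih => exact hnext1 n (p n) ih
  have hδlim : Tendsto δ atTop (𝓝 0) :=
    squeeze_zero (fun n => (hδ0 n).le) hδn
      (tendsto_pow_atTop_nhds_zero_of_lt_one (by norm_num) (by norm_num))
  have hcauchy : CauchySeq p := by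
    refine cauchySeq_of_le_geometric (1 / 2) 2 (by norm_num) fun n => ?_
    exact (hnext2 n (p n) (hp n)).trans (by linarith [hδn n])
  obtain ⟨l, hl⟩ := cauchySeq_tendsto_of_complete hcauchy
  refine ⟨l, fun x hx => ?_⟩
  have h1 : Tendsto (fun n => dist (p n) x - t x) atTop (𝓝 0) :=
    squeeze_zero_norm (fun n => (hp n x hx).le) hδlim
  have h2 : Tendsto (fun n => dist (p n) x - t x) atTop (𝓝 (dist l x - t x)) :=
    (hl.dist tendsto_const_nhds).sub_const _
  exact sub_eq_zero.1 (tendsto_nhds_unique h2 h1)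

/-! ### Partial isometries -/

/-- `S` is the graph of a partial isometry. -/
def PartialIsometry {Y X : Type*} [MetricSpace Y] [MetricSpace X] (S : Set (Y × X)) : Prop :=
  ∀ p ∈ S, ∀ q ∈ S, dist p.1 q.1 = dist p.2 q.2

section
variable {X Y : Type*} [MetricSpace X] [MetricSpace Y] {S : Set (Y × X)}

theorem PartialIsometry.swap (hS : PartialIsometry S) : PartialIsometry (Prod.swap '' S) := by
  rintro _ ⟨p, hp, rfl⟩ _ ⟨q, hq, rfl⟩
  exact (hS p hp q hq).symm

theorem PartialIsometry.topologicalClosure (hS : PartialIsometry S) : PartialIsometry (closure S) := by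
  have hcl : IsClosed {z : (Y × X) × (Y × X) | dist z.1.1 z.2.1 = dist z.1.2 z.2.2} :=
    isClosed_eq (by fun_prop) (by fun_prop)
  have hsub := closure_minimal (s := S ×ˢ S) (fun z hz => hS z.1 hz.1 z.2 hz.2) hcl
  rw [closure_prod_eq] at hsub
  exact fun p hp q hq => hsub (mk_mem_prod hp hq)

theorem PartialIsometry.exists_mem_closure [CompleteSpace X] (hS : PartialIsometry S)
    (hd : Dense (Prod.fst '' S)) (x : Y) : ∃ y, (x, y) ∈ closure S := by
  obtain ⟨u, hu, hux⟩ := mem_closure_iff_seq_limit.1 (hd x)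
  choose v hv hvu using hu
  have hc : CauchySeq fun n => (v n).2 := by
    have := hux.cauchySeq
    rw [Metric.cauchySeq_iff] at this ⊢
    simpa only [← hS _ (hv _) _ (hv _), hvu] using this
  obtain ⟨y, hy⟩ := cauchySeq_tendsto_of_complete hc
  refine ⟨y, mem_closure_iff_seq_limit.2 ⟨v, hv, ?_⟩⟩
  exact Tendsto.prodMk_nhds (by simpa only [hvu] using hux) hy

theorem PartialIsometry.exists_isometryEquiv [CompleteSpace X] [CompleteSpace Y]
    (hS : PartialIsometry S) (h1 : Dense (Prod.fst '' S)) (h2 : Dense (Prod.snd '' S)) :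
    ∃ g : Y ≃ᵢ X, ∀ p ∈ S, g p.1 = p.2 := by
  choose g hg using hS.exists_mem_closure h1
  choose k hk using hS.swap.exists_mem_closure (by rwa [image_image])
  have hk' : ∀ y, (k y, y) ∈ closure S := by
    intro y
    have hmaps : MapsTo Prod.swap (Prod.swap '' S) S := by
      rintro _ ⟨p, hp, rfl⟩
      simpa using hp
    exact map_mem_closure (x := (y, k y)) continuous_swap (hk y) hmaps
  have heq : ∀ p ∈ closure S, g p.1 = p.2 := fun p hp => by
    have := hS.topologicalClosure _ (hg p.1) p hp
    simpa [eq_comm] using this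
  refine ⟨IsometryEquiv.mk' g k (fun y => heq _ (hk' y)) ?_, fun p hp => heq p (subset_closure hp)⟩
  exact Isometry.of_dist_eq fun x y => (hS.topologicalClosure _ (hg x) _ (hg y)).symm

theorem PartialIsometry.exists_insert (hS : PartialIsometry S) (hfin : S.Finite)
    (hE : ExtensionProperty R X) (hY : ∀ x y : Y, dist x y ∈ R) (u : Y) :
    ∃ v, PartialIsometry (insert (u, v) S) := by
  classical
  have hex : ∀ y ∈ Prod.snd '' S, ∃ x, (x, y) ∈ S := by
    rintro _ ⟨p, hp, rfl⟩
    exact ⟨p.1, hp⟩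
  have : Nonempty Y := ⟨u⟩
  choose! k hk using hex
  obtain ⟨v, hv⟩ := hE (Prod.snd '' S) (hfin.image _) (fun y => dist u (k y))
    ⟨fun _ _ => hY _ _, fun x hx y hy => by
      rw [← show dist (k x) (k y) = dist x y from hS _ (hk x hx) _ (hk y hy)]
      exact metricTriple_dist _ _ _⟩
  have hv' : ∀ p ∈ S, dist u p.1 = dist v p.2 := by
    intro p hp
    have hm := mem_image_of_mem Prod.snd hp
    rw [hv _ hm]
    have := hS _ (hk _ hm) p hp
    rw [dist_self, dist_eq_zero] at this
    rw [show k p.2 = p.1 from this]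
  refine ⟨v, ?_⟩
  rintro p (rfl | hp) q (rfl | hq)
  · simp
  · exact hv' q hq
  · simpa only [dist_comm] using hv' p hp
  · exact hS p hp q hq

/-- A step that enlarges finite partial isometries can be iterated along a sequence of tasks. -/
theorem PartialIsometry.exists_limit {P : ℕ → Set (Y × X) → Prop}
    (hP : ∀ n S T, S ⊆ T → P n S → P n T)
    (hstep : ∀ n (S : Set (Y × X)), PartialIsometry S → S.Finite →
      ∃ T, S ⊆ T ∧ PartialIsometry T ∧ T.Finite ∧ P n T)
    (hS : PartialIsometry S) (hfin : S.Finite) :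
    ∃ T, S ⊆ T ∧ PartialIsometry T ∧ ∀ n, P n T := by
  choose! next h1 h2 h3 h4 using hstep
  let A : ℕ → Set (Y × X) := fun n => Nat.rec S next n
  have hA : ∀ n, PartialIsometry (A n) ∧ (A n).Finite := by
    intro n
    induction n with
    | zero => exact ⟨hS, hfin⟩
    | succ n ih => exact ⟨h2 n _ ih.1 ih.2, h3 n _ ih.1 ih.2⟩
  have hmono : Monotone A := monotone_nat_of_le_succ fun n => h1 n _ (hA n).1 (hA n).2
  refine ⟨⋃ n, A n, subset_iUnion A 0, ?_, fun n => ?_⟩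
  · intro p hp q hq
    obtain ⟨i, hi⟩ := mem_iUnion.1 hp
    obtain ⟨j, hj⟩ := mem_iUnion.1 hq
    exact (hA (max i j)).1 p (hmono (le_max_left i j) hi) q (hmono (le_max_right i j) hj)
  · exact hP n _ _ (subset_iUnion A (n + 1)) (h4 n _ (hA n).1 (hA n).2)

theorem ExtensionProperty.exists_embedding [CompleteSpace X] [TopologicalSpace.SeparableSpace Y]
    (hE : ExtensionProperty R X) (hY : ∀ x y : Y, dist x y ∈ R) :
    ∃ f : Y → X, ∀ a b, dist (f a) (f b) = dist a b := by
  rcases isEmpty_or_nonempty Y with hempty | hne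
  · exact ⟨hempty.elim, fun a => hempty.elim a⟩
  let u := TopologicalSpace.denseSeq Y
  obtain ⟨T, -, hT, hu⟩ := PartialIsometry.exists_limit
    (P := fun n (T : Set (Y × X)) => u n ∈ Prod.fst '' T) (S := ∅)
    (fun n S T hST h => image_mono hST h)
    (fun n S hS hfin => by
      obtain ⟨v, hv⟩ := hS.exists_insert hfin hE hY (u n)
      exact ⟨_, subset_insert _ _, hv, hfin.insert _, (u n, v), mem_insert _ _, rfl⟩)
    (fun p hp => hp.elim) finite_empty
  have hdense : Dense (Prod.fst '' T) :=
    (TopologicalSpace.denseRange_denseSeq Y).mono (range_subset_iff.2 hu)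
  choose f hf using hT.exists_mem_closure hdense
  exact ⟨f, fun a b => (hT.topologicalClosure _ (hf a) _ (hf b)).symm⟩

theorem ExtensionProperty.isHomogeneous [CompleteSpace X] [TopologicalSpace.SeparableSpace X]
    (hE : ExtensionProperty R X) (hX : ∀ x y : X, dist x y ∈ R) : IsHomogeneous X := by
  intro F hF f hf
  rcases isEmpty_or_nonempty X with hempty | hne
  · exact ⟨IsometryEquiv.refl X, fun x => hempty.elim x⟩
  have := hF.to_subtype
  let u := TopologicalSpace.denseSeq X
  obtain ⟨T, hST, hT, hu⟩ := PartialIsometry.exists_limit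
    (P := fun n (T : Set (X × X)) => u n ∈ Prod.fst '' T ∧ u n ∈ Prod.snd '' T)
    (S := range fun x : F => ((x : X), f x))
    (fun n S T hST h => ⟨image_mono hST h.1, image_mono hST h.2⟩)
    (fun n S hS hfin => by
      obtain ⟨v, hv⟩ := hS.exists_insert hfin hE hX (u n)
      obtain ⟨w, hw⟩ := hv.swap.exists_insert ((hfin.insert _).image _) hE hX (u n)
      refine ⟨insert (w, u n) (insert (u n, v) S),
        (subset_insert _ _).trans (subset_insert _ _), ?_, (hfin.insert _).insert _,
        ⟨(u n, v), by simp, rfl⟩, ⟨(w, u n), by simp, rfl⟩⟩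
      have := hw.swap
      simpa only [image_insert_eq, image_image, Prod.swap_prod_mk, Prod.swap_swap, image_id']
        using this)
    (by rintro _ ⟨x, rfl⟩ _ ⟨y, rfl⟩; exact (hf x y).symm) (finite_range _)
  have hd := TopologicalSpace.denseRange_denseSeq X
  obtain ⟨g, hg⟩ := hT.exists_isometryEquiv (hd.mono (range_subset_iff.2 fun n => (hu n).1))
    (hd.mono (range_subset_iff.2 fun n => (hu n).2))
  exact ⟨g, fun x => hg _ (hST (mem_range_self x))⟩

end

theorem ApproxExtension.exists_isUrysohn {α : Type} [PseudoMetricSpace α] [Countable α]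
    [Nonempty α] (hR : R ⊆ Ici 0) (h0 : (0 : ℝ) ∈ R) (hlim : ZeroLimit R) (hcl : IsClosed R)
    (h4 : FourValues R) (hα : ∀ x y : α, dist x y ∈ R)
    (hA : ApproxExtension R (dist : α → α → ℝ)) :
    ∃ (X : Type) (inst : MetricSpace X), @IsUrysohn X inst ∧ @distSet X inst = R := by
  let X := UniformSpace.Completion α
  have hX : ∀ x y : X, dist x y ∈ R := by
    intro x y
    refine UniformSpace.Completion.induction_on₂ x y (hcl.preimage continuous_dist) ?_
    intro a b
    rw [UniformSpace.Completion.dist_eq]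
    exact hα a b
  have hE : ExtensionProperty R X :=
    ApproxExtension.extensionProperty hlim hX (ApproxExtension.completion h4 h0 hA hX)
  have hdist : distSet X = R := by
    refine Subset.antisymm ?_ fun r hr => ?_
    · rintro _ ⟨x, y, rfl⟩
      exact hX x y
    · let x : X := (Classical.arbitrary α : α)
      have hr0 : 0 ≤ r := hR hr
      obtain ⟨p, hp⟩ := hE {x} (finite_singleton x) (fun _ => r)
        ⟨fun _ _ => hr, by
          rintro _ rfl _ rfl
          simp [MetricTriple, hr0]⟩
      exact ⟨p, x, hp x rfl⟩
  refine ⟨X, inferInstance, ⟨hE.isHomogeneous hX, inferInstance, inferInstance, ?_⟩, hdist⟩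
  intro N _ _ hN
  exact hE.exists_embedding fun x y => hdist ▸ hN ⟨x, y, rfl⟩

theorem exists_isUrysohn (hR : R ⊆ Ici 0) (h0 : (0 : ℝ) ∈ R) (hlim : ZeroLimit R)
    (hcl : IsClosed R) (h4 : FourValues R) :
    ∃ (X : Type) (inst : MetricSpace X), @IsUrysohn X inst ∧ @distSet X inst = R := by
  obtain ⟨d, hd, hA⟩ := exists_approxExtension h4 h0
  exact @ApproxExtension.exists_isUrysohn R ℕ
    { dist := d, dist_self := hd.self, dist_comm := hd.symm, dist_triangle := hd.triangle }
    _ _ hR h0 hlim hcl h4 hd.mem hA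

/-! ### Distance sets of Urysohn spaces -/

section
variable {U : Type} [MetricSpace U]

theorem exists_triangle (hU : IsUrysohn U) {x a b : ℝ} (h : MetricTriple x a b)
    (hx : x ∈ distSet U) (ha : a ∈ distSet U) (hb : b ∈ distSet U) (hx0 : 0 ∈ distSet U) :
    ∃ p q r : U, dist p q = x ∧ dist r p = a ∧ dist r q = b := by
  have hn : ∀ {s}, s ∈ distSet U → 0 ≤ s := by
    rintro _ ⟨y, z, rfl⟩
    exact dist_nonneg
  let p : ℝ × ℝ := (0, a)
  let q : ℝ × ℝ := (x, b)
  let r : ℝ × ℝ := (a, 0)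
  have hxn := hn hx
  have han := hn ha
  have hbn := hn hb
  have hpq : dist p q = x := by
    have := h.rotate.1
    simp [p, q, Prod.dist_eq, Real.dist_eq, abs_of_nonneg hxn, this]
  have hrp : dist r p = a := by
    simp [p, r, Prod.dist_eq, Real.dist_eq, abs_of_nonneg han]
  have hrq : dist r q = b := by
    have := h.1
    rw [abs_sub_comm] at this
    simp [r, q, Prod.dist_eq, Real.dist_eq, abs_of_nonneg hbn, this]
  let N : Set (ℝ × ℝ) := {p, q, r}
  have hp : p ∈ N := by simp [N]
  have hq : q ∈ N := by simp [N]
  have hr : r ∈ N := by simp [N]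
  obtain ⟨f, hf⟩ := hU.2.2.2 N (by
    rintro _ ⟨⟨y, hy⟩, ⟨z, hz⟩, rfl⟩
    change dist y z ∈ _
    rcases hy with rfl | rfl | rfl <;> rcases hz with rfl | rfl | rfl <;>
    first
    | rwa [dist_self]
    | rwa [hpq]
    | rwa [hrp]
    | rwa [hrq]
    | rwa [dist_comm, hpq]
    | rwa [dist_comm, hrp]
    | rwa [dist_comm, hrq])
  exact ⟨f ⟨p, hp⟩, f ⟨q, hq⟩, f ⟨r, hr⟩, (hf _ _).trans hpq, (hf _ _).trans hrp,
    (hf _ _).trans hrq⟩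

theorem exists_apex (hU : IsUrysohn U) {a b : ℝ} (ha : a ∈ distSet U)
    (hb : b ∈ distSet U) {p q : U} (h : MetricTriple (dist p q) a b) :
    ∃ r : U, dist r p = a ∧ dist r q = b := by
  obtain ⟨p', q', r, h1, h2, h3⟩ := exists_triangle hU h ⟨p, q, rfl⟩ ha hb ⟨p, p, dist_self p⟩
  classical
  obtain ⟨g, hg⟩ := hU.1 {p', q'} (by simp) (fun z => if (z : U) = p' then p else q) (by
    rintro ⟨y, rfl | rfl⟩ ⟨z, rfl | rfl⟩
    · simp
    · by_cases hzy : z = y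
      · simp [hzy]
      · simp [hzy, h1]
    · by_cases hzy : y = z
      · simp [hzy]
      · simp [hzy, dist_comm q p, dist_comm y z, h1]
    · simp)
  have hgp : g p' = p := by simpa using hg ⟨p', by simp⟩
  have hgq : g q' = q := by
    have := hg ⟨q', by simp⟩
    by_cases hqp : q' = p'
    · have hpq : p = q := by rw [← dist_eq_zero, ← h1, hqp, dist_self]
      rw [hqp, hgp, hpq]
    · simpa [hqp] using this
  exact ⟨g r, by rw [← hgp, g.dist_eq, h2], by rw [← hgq, g.dist_eq, h3]⟩

theorem fourValues_distSet (hU : IsUrysohn U) : FourValues (distSet U) := by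
  rintro a b c d ha hb hc hd ⟨_, ⟨p, q, rfl⟩, h1, h2, hba, hca, hda⟩
  obtain ⟨r, hrp, hrq⟩ := exists_apex hU ha hb h1
  obtain ⟨s, hsp, hsq⟩ := exists_apex hU hd hc (p := p) (q := q)
    h2.swap_right
  refine ⟨dist r s, ⟨r, s, rfl⟩, ?_, ?_, hda, hca, hba⟩
  · have := metricTriple_dist r s p
    rwa [hrp, hsp] at this
  · have := metricTriple_dist s r q
    rwa [hrq, hsq, dist_comm s r] at this

theorem isClosed_distSet (hU : IsUrysohn U) (hlim : ZeroLimit (distSet U)) :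
    IsClosed (distSet U) := by
  refine isClosed_of_closure_subset fun r hr => ?_
  have hn : ∀ {s}, s ∈ distSet U → 0 ≤ s := by
    rintro _ ⟨y, z, rfl⟩
    exact dist_nonneg
  have hr0 : 0 ≤ r := closure_minimal (fun s hs => hn hs) isClosed_Ici hr
  obtain ⟨_, ⟨x₀, y₀, rfl⟩, -⟩ := hlim 1 one_pos
  rcases hr0.eq_or_lt with rfl | hr0
  · exact ⟨x₀, x₀, dist_self _⟩
  choose δ hδR hδ0 hδ using fun n : ℕ =>
    hlim (min r ((1 / 2) ^ n)) (lt_min hr0 (by positivity))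
  have hδr : ∀ n, δ n < r := fun n => (hδ n).trans_le (min_le_left _ _)
  have hδn : ∀ n, δ n ≤ (1 / 2) ^ n := fun n => (hδ n).le.trans (min_le_right _ _)
  choose s hsR hs using fun n : ℕ => Metric.mem_closure_iff.1 hr
    (min (δ n) (δ (n - 1)) / 2) (half_pos (lt_min (hδ0 n) (hδ0 _)))
  obtain ⟨x, y₀, hxy₀⟩ := hsR 0
  have step : ∀ n y, dist x y = s n → ∃ y', dist x y' = s (n + 1) ∧ dist y y' = δ n := by
    intro n y hy
    have h1 := hs n
    have h2 := hs (n + 1)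
    rw [Nat.add_sub_cancel, Real.dist_eq, abs_lt] at h2
    rw [Real.dist_eq, abs_lt] at h1
    have h3 := min_le_left (δ n) (δ (n - 1))
    have h5 := min_le_right (δ (n + 1)) (δ n)
    have h6 := hδr n
    obtain ⟨y', h7, h8⟩ := exists_apex hU (p := x) (q := y) (hsR (n + 1)) (hδR n)
      (by rw [hy]; exact ⟨abs_le.2 ⟨by linarith, by linarith⟩, by linarith⟩)
    exact ⟨y', by rwa [dist_comm], by rwa [dist_comm]⟩
  choose! next hnext1 hnext2 using step
  let y : ℕ → U := fun n => Nat.rec y₀ next n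
  have hy : ∀ n, dist x (y n) = s n := by
    intro n
    induction n with
    | zero => exact hxy₀
    | succ n ih => exact hnext1 n (y n) ih
  have hcauchy : CauchySeq y := by
    refine cauchySeq_of_le_geometric (1 / 2) 1 (by norm_num) fun n => ?_
    rw [one_mul]
    exact (hnext2 n (y n) (hy n)).trans_le (hδn n)
  have := hU.2.2.1
  obtain ⟨l, hl⟩ := cauchySeq_tendsto_of_complete hcauchy
  have hsr : Tendsto s atTop (𝓝 r) := by
    rw [tendsto_iff_dist_tendsto_zero]
    refine squeeze_zero (fun n => dist_nonneg) (fun n => ?_)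
      (tendsto_pow_atTop_nhds_zero_of_lt_one (r := (1 / 2 : ℝ)) (by norm_num) (by norm_num))
    rw [dist_comm]
    linarith [hs n, hδn n, hδ0 n, min_le_left (δ n) (δ (n - 1))]
  refine ⟨x, l, tendsto_nhds_unique (tendsto_const_nhds.dist hl) ?_⟩
  simpa only [hy] using hsr

end

/-- For `0 ∈ R ⊆ [0,∞)` with `0` a limit point of `R`, there exists an
Urysohn metric space with distance set `R` iff `R` is closed and satisfies the
4-values condition. -/
theorem statement0 (R : Set ℝ) (hR : R ⊆ Set.Ici 0) (h0 : (0 : ℝ) ∈ R)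
    (hlim : ZeroLimit R) :
    (∃ (X : Type) (inst : MetricSpace X), @IsUrysohn X inst ∧ @distSet X inst = R) ↔
      IsClosed R ∧ FourValues R := by
  constructor
  · rintro ⟨X, inst, hX, rfl⟩
    exact ⟨isClosed_distSet hX hlim, fourValues_distSet hX⟩
  · rintro ⟨hcl, h4⟩
    exact exists_isUrysohn hR h0 hlim hcl h4
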